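/- Let H be an infinite-dimensional separable real or complex Hilbert space and let B be a positive bounded operator on H with ‖B‖_ess > 1. Let {c_i}_{i=1}^∞ be any sequence of real numbers with 0 < c_i ≤ 1 for all i and Σ_i c_i = ∞. Then there exists a sequence {P_i}_{i=1}^∞ of rank-one orthogonal projections on H such that B = Σ_{i=1}^∞ c_i P_i, with convergence in the strong operator topology. -/

import Mathlib

open scoped InnerProductSpace

/-- The rank-one operator `u ⊗ v : x ↦ ⟨x, v⟩ u` (inner product linear in `x`). -/
noncomputable def rankOne (𝕜 : Type*) {H : Type*} [RCLike 𝕜] [NormedAddCommGroup H]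
    [InnerProductSpace 𝕜 H] (u v : H) : H →L[𝕜] H :=
  (innerSL 𝕜 v).smulRight u

/-- The essential norm of a bounded operator: `‖B‖_ess = inf {‖B - K‖ : K compact}`. -/
noncomputable def essNorm {𝕜 H : Type*} [RCLike 𝕜] [NormedAddCommGroup H]
    [InnerProductSpace 𝕜 H] (B : H →L[𝕜] H) : ℝ :=
  sInf ((fun K => ‖B - K‖) '' {K : H →L[𝕜] H | IsCompactOperator K})

/-- Any nonnegative Hermitian form is the pull-back of the inner product of a Hilbert space. -/
lemma PreInnerProductSpace.Core.exists_completion.{u, v} {𝕜 : Type u} {F : Type v}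
    [RCLike 𝕜] [AddCommGroup F] [Module 𝕜 F] (core : PreInnerProductSpace.Core 𝕜 F) :
    ∃ (K : Type v) (_ : NormedAddCommGroup K) (_ : InnerProductSpace 𝕜 K) (_ : CompleteSpace K)
      (J : F →ₗ[𝕜] K), DenseRange J ∧ ∀ x y, ⟪J x, J y⟫_𝕜 = core.inner x y := by
  let _ : SeminormedAddCommGroup F := InnerProductSpace.Core.toSeminormedAddCommGroup (𝕜 := 𝕜)
  let _ : InnerProductSpace 𝕜 F := InnerProductSpace.ofCore core
  refine ⟨UniformSpace.Completion F, inferInstance, inferInstance, inferInstance,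
    (UniformSpace.Completion.toComplₗᵢ (𝕜 := 𝕜) (E := F)).toLinearMap, ?_, fun x y => ?_⟩
  · exact UniformSpace.Completion.denseRange_coe
  · exact UniformSpace.Completion.inner_coe x y

/-- A positive operator `B` factors as `J† J` with `J` having dense range. -/
lemma ContinuousLinearMap.IsPositive.exists_factorization.{u, v} {𝕜 : Type u} {H : Type v}
    [RCLike 𝕜] [NormedAddCommGroup H] [InnerProductSpace 𝕜 H] {B : H →L[𝕜] H} (hB : B.IsPositive) :
    ∃ (K : Type v) (_ : NormedAddCommGroup K) (_ : InnerProductSpace 𝕜 K) (_ : CompleteSpace K)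
      (J : H →L[𝕜] K), DenseRange J ∧ ∀ x y, ⟪J x, J y⟫_𝕜 = ⟪B x, y⟫_𝕜 := by
  have hsymm : ∀ x y, ⟪B x, y⟫_𝕜 = ⟪x, B y⟫_𝕜 := hB.isSymmetric
  let core : PreInnerProductSpace.Core 𝕜 H :=
    { inner := fun x y => ⟪B x, y⟫_𝕜
      conj_inner_symm := fun x y => by rw [inner_conj_symm, hsymm]
      re_inner_nonneg := fun x => hB.re_inner_nonneg_left x
      add_left := fun x y z => by rw [map_add, inner_add_left]
      smul_left := fun x y r => by rw [map_smul, inner_smul_left] }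
  obtain ⟨K, _, _, _, J, hJ, hin'⟩ := core.exists_completion
  have hin : ∀ x y, ⟪J x, J y⟫_𝕜 = ⟪B x, y⟫_𝕜 := hin'
  have hbound : ∀ x, ‖J x‖ ≤ √‖B‖ * ‖x‖ := fun x => by
    rw [← Real.sqrt_sq (norm_nonneg x), ← Real.sqrt_mul (norm_nonneg B)]
    refine Real.le_sqrt_of_sq_le ?_
    calc ‖J x‖ ^ 2 = RCLike.re ⟪J x, J x⟫_𝕜 := norm_sq_eq_re_inner _
      _ = RCLike.re ⟪B x, x⟫_𝕜 := by rw [hin]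
      _ ≤ ‖B x‖ * ‖x‖ := re_inner_le_norm _ _
      _ ≤ ‖B‖ * ‖x‖ * ‖x‖ := by gcongr; exact B.le_opNorm x
      _ = ‖B‖ * ‖x‖ ^ 2 := by ring
  exact ⟨K, inferInstance, inferInstance, inferInstance, J.mkContinuous _ hbound, hJ, hin⟩

lemma essNorm_le_norm_sub {𝕜 H : Type*} [RCLike 𝕜] [NormedAddCommGroup H]
    [InnerProductSpace 𝕜 H] (B : H →L[𝕜] H) {C : H →L[𝕜] H} (hC : IsCompactOperator C) :
    essNorm B ≤ ‖B - C‖ :=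
  csInf_le ⟨0, by rintro _ ⟨D, -, rfl⟩; exact norm_nonneg _⟩ ⟨C, hC, rfl⟩

/-- If `T T† = B`, then `‖T g‖ ^ 2` is nearly `essNorm B` for some unit vector `g` orthogonal to
any given finite-dimensional subspace. -/
lemma exists_unit_mem_orthogonal_lt_norm_sq {𝕜 H K : Type*} [RCLike 𝕜]
    [NormedAddCommGroup H] [InnerProductSpace 𝕜 H] [CompleteSpace H]
    [NormedAddCommGroup K] [InnerProductSpace 𝕜 K] [CompleteSpace K]
    {B : H →L[𝕜] H} {T : K →L[𝕜] H} (hT : T ∘L T.adjoint = B) {r : ℝ} (hr0 : 0 ≤ r)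
    (hr : r < essNorm B) (V : Submodule 𝕜 K) [FiniteDimensional 𝕜 V] :
    ∃ g ∈ Vᗮ, ‖g‖ = 1 ∧ r < ‖T g‖ ^ 2 := by
  by_contra! hcon
  have hle : ∀ g ∈ Vᗮ, ‖T g‖ ≤ √r * ‖g‖ := fun g hg => by
    rcases eq_or_ne g 0 with rfl | hg0
    · simp
    have hpos : 0 < ‖g‖ := norm_pos_iff.2 hg0
    have h := hcon (((‖g‖⁻¹ : ℝ) : 𝕜) • g) (Submodule.smul_mem _ _ hg)
      (by rw [norm_smul, RCLike.norm_ofReal, abs_of_pos (inv_pos.2 hpos),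
        inv_mul_cancel₀ hpos.ne'])
    rw [map_smul, norm_smul, RCLike.norm_ofReal, abs_of_pos (inv_pos.2 hpos)] at h
    have h := Real.le_sqrt_of_sq_le h
    rwa [inv_mul_le_iff₀ hpos, mul_comm] at h
  set P : K →L[𝕜] K := Vᗮ.starProjection with hP
  have hTP : ‖T ∘L P‖ ≤ √r := ContinuousLinearMap.opNorm_le_bound _ (Real.sqrt_nonneg _) fun x =>
    (hle _ (Submodule.starProjection_apply_mem _ x)).trans
      (by gcongr; exact Submodule.norm_starProjection_apply_le _ x)
  have hcomp : IsCompactOperator (T ∘L V.starProjection ∘L T.adjoint) := by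
    have h1 : IsCompactOperator (V.orthogonalProjectionOnto ∘L T.adjoint) :=
      haveI : ProperSpace V := FiniteDimensional.proper 𝕜 V
      isCompactOperator_of_locallyCompactSpace_dom (V.orthogonalProjectionOnto ∘L T.adjoint)
    exact h1.clm_comp (T ∘L V.subtypeL)
  have hPsa : P.adjoint = P := (isSelfAdjoint_starProjection Vᗮ).adjoint_eq
  have heq : B - T ∘L V.starProjection ∘L T.adjoint = (T ∘L P) ∘L (T ∘L P).adjoint := by
    have hPP : ∀ x, P (P x) = P x := fun x =>
      Submodule.starProjection_eq_self_iff.2 (Submodule.starProjection_apply_mem _ x)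
    rw [ContinuousLinearMap.adjoint_comp, hPsa, ← hT]
    ext x
    simp only [sub_apply, ContinuousLinearMap.comp_apply, hPP]
    rw [hP, Submodule.starProjection_orthogonal_val, map_sub]
  have := essNorm_le_norm_sub B hcomp
  rw [heq] at this
  have h2 : ‖(T ∘L P) ∘L (T ∘L P).adjoint‖ ≤ √r * √r :=
    (ContinuousLinearMap.opNorm_comp_le _ _).trans (by
      rw [LinearIsometryEquiv.norm_map]
      gcongr)
  rw [Real.mul_self_sqrt hr0] at h2
  linarith

/-- A sequence of positive terms with divergent sum can be split into infinitely many
subsequences, each with divergent sum. -/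
lemma exists_partition_not_summable {c : ℕ → ℝ} (hcpos : ∀ i, 0 < c i) (hcle : ∀ i, c i ≤ 1)
    (hdiv : Filter.Tendsto (fun N => ∑ i ∈ Finset.range N, c i) Filter.atTop Filter.atTop) :
    ∃ τ : ℕ → ℕ, ∀ j, ¬ Summable (fun n => if τ n = j then c n else 0) := by
  set t : ℕ → ℝ := fun N => ∑ i ∈ Finset.range N, c i with ht
  have ht_succ : ∀ n, t (n + 1) = t n + c n := fun n => Finset.sum_range_succ _ _
  have ht_mono : Monotone t := monotone_nat_of_le_succ fun n => by
    rw [ht_succ]; linarith [hcpos n]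
  have ht_nonneg : ∀ n, 0 ≤ t n := fun n => Finset.sum_nonneg fun i _ => (hcpos i).le
  refine ⟨fun n => (Nat.unpair ⌊t n / 2⌋₊).1, fun j hsum => ?_⟩
  obtain ⟨s, hs⟩ := summable_iff_vanishing_norm.1 hsum 1 one_pos
  obtain ⟨N, hN⟩ := s.exists_nat_subset_range
  obtain ⟨l, hl⟩ := exists_nat_gt (t N)
  set m := Nat.pair j (l + 1) with hm
  have hlm : ((l + 1 : ℕ) : ℝ) ≤ m := by exact_mod_cast Nat.right_le_pair j (l + 1)
  push_cast at hlm
  have hex : ∀ R : ℝ, ∃ n, R ≤ t n := fun R => (hdiv.eventually_ge_atTop R).exists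
  classical
  set a := Nat.find (hex (2 * m)) with ha
  set b := Nat.find (hex (2 * m + 2)) with hb
  have ha1 : 2 * (m : ℝ) ≤ t a := Nat.find_spec (hex (2 * m))
  have hb1 : 2 * (m : ℝ) + 2 ≤ t b := Nat.find_spec (hex (2 * m + 2))
  have ha0 : t 0 = 0 := by simp [ht]
  have ha2 : t a ≤ 2 * m + 1 := by
    rcases Nat.eq_zero_or_pos a with h | h
    · rw [h, ha0]; positivity
    · obtain ⟨k, hk⟩ := Nat.exists_eq_succ_of_ne_zero h.ne'
      have := Nat.find_min (hex (2 * m)) (m := k) (by omega)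
      rw [hk, Nat.succ_eq_add_one, ht_succ]
      linarith [hcle k]
  have hab : a ≤ b := Nat.find_min' _ (by linarith)
  have hmem : ∀ n ∈ Finset.Ico a b, (Nat.unpair ⌊t n / 2⌋₊).1 = j := fun n hn => by
    rw [Finset.mem_Ico] at hn
    have h1 := ht_mono hn.1
    have h2 := Nat.find_min (hex (2 * m + 2)) hn.2
    have : ⌊t n / 2⌋₊ = m := by
      rw [Nat.floor_eq_iff (by linarith [ht_nonneg n])]
      constructor <;> linarith
    rw [this, hm, Nat.unpair_pair]
  have hdisj : Disjoint (Finset.Ico a b) s := by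
    rw [Finset.disjoint_left]
    intro n hn hns
    have h1 : n < N := Finset.mem_range.1 (hN hns)
    have h2 := ht_mono h1.le
    have h3 := ht_mono (Finset.mem_Ico.1 hn).1
    have := ht_nonneg N
    linarith
  have := hs _ hdisj
  rw [Finset.sum_congr rfl fun n hn => if_pos (hmem n hn), Finset.sum_Ico_eq_sub _ hab] at this
  have := (le_abs_self _).trans_lt this
  change t b - t a < 1 at this
  linarith

lemma norm_sq_sqrt_smul_add {𝕜 E : Type*} [RCLike 𝕜] [NormedAddCommGroup E]
    [InnerProductSpace 𝕜 E] {s : ℝ} (hs0 : 0 ≤ s) (hs1 : s ≤ 1) {u v : E} (huv : ⟪u, v⟫_𝕜 = 0) :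
    ‖((√s : ℝ) : 𝕜) • u + ((√(1 - s) : ℝ) : 𝕜) • v‖ ^ 2 = s * ‖u‖ ^ 2 + (1 - s) * ‖v‖ ^ 2 := by
  have hsq : ∀ a : ℝ, 0 ≤ a → ‖((√a : ℝ) : 𝕜)‖ ^ 2 = a := fun a ha => by
    rw [RCLike.norm_ofReal, sq_abs, Real.sq_sqrt ha]
  rw [norm_add_sq (𝕜 := 𝕜), inner_smul_left, inner_smul_right, huv, norm_smul, norm_smul,
    mul_pow, mul_pow, hsq s hs0, hsq (1 - s) (by linarith)]
  simp

/-- Rotating from `f` towards `g` by an angle of squared cosine `s` interpolates `‖T f‖ ^ 2` and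
`‖T g‖ ^ 2` linearly in `s`. -/
lemma exists_unit_interpolating {𝕜 H K : Type*} [RCLike 𝕜]
    [NormedAddCommGroup H] [InnerProductSpace 𝕜 H]
    [NormedAddCommGroup K] [InnerProductSpace 𝕜 K] (T : K →L[𝕜] H) (V : Submodule 𝕜 K) {f g : K}
    (hf : f ∈ V) (hg : g ∈ V) (hf1 : ‖f‖ = 1) (hg1 : ‖g‖ = 1) (hfg : ⟪f, g⟫_𝕜 = 0)
    (hTfg : ⟪T f, T g⟫_𝕜 = 0) {s : ℝ} (hs0 : 0 ≤ s) (hs1 : s ≤ 1) :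
    ∃ y ∈ V, ‖y‖ = 1 ∧ ‖T y‖ ^ 2 = s * ‖T f‖ ^ 2 + (1 - s) * ‖T g‖ ^ 2 ∧
      ‖⟪y, f⟫_𝕜‖ ^ 2 = s := by
  refine ⟨((√s : ℝ) : 𝕜) • f + ((√(1 - s) : ℝ) : 𝕜) • g,
    V.add_mem (V.smul_mem _ hf) (V.smul_mem _ hg), ?_, ?_, ?_⟩
  · have h := norm_sq_sqrt_smul_add hs0 hs1 hfg
    rw [hf1, hg1, one_pow, mul_one, mul_one, add_sub_cancel] at h
    exact (pow_eq_one_iff_of_nonneg (norm_nonneg _) two_ne_zero).1 h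
  · rw [map_add, map_smul, map_smul, norm_sq_sqrt_smul_add hs0 hs1 hTfg]
  · rw [inner_add_left, inner_smul_left, inner_smul_left, inner_eq_zero_symm.1 hfg, mul_zero,
      add_zero, inner_self_eq_norm_sq_to_K, hf1]
    simp [hs0]

section DiagonalBasis

variable {𝕜 H K : Type*} [RCLike 𝕜]
  [NormedAddCommGroup H] [InnerProductSpace 𝕜 H] [CompleteSpace H]
  [NormedAddCommGroup K] [InnerProductSpace 𝕜 K] [CompleteSpace K]
  {T : K →L[𝕜] H} {r : ℝ}

/-- One extension step: a unit vector `y ⟂ V` with `‖T y‖ ^ 2 = c` capturing a proportion of the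
unit vector `f ⟂ V` comparable to `c`. -/
lemma exists_unit_norm_sq_eq_of_unit (hr : 1 < r)
    (hlarge : ∀ V : Submodule 𝕜 K, FiniteDimensional 𝕜 V → ∃ g ∈ Vᗮ, ‖g‖ = 1 ∧ r < ‖T g‖ ^ 2)
    (hzero : ∀ V : Submodule 𝕜 K, FiniteDimensional 𝕜 V → ∃ g ∈ Vᗮ, ‖g‖ = 1 ∧ T g = 0)
    (V : Submodule 𝕜 K) [FiniteDimensional 𝕜 V] {f : K} (hfV : f ∈ Vᗮ) (hf1 : ‖f‖ = 1)
    {c : ℝ} (hc0 : 0 < c) (hc1 : c ≤ 1) :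
    ∃ y ∈ Vᗮ, ‖y‖ = 1 ∧ ‖T y‖ ^ 2 = c ∧
      min (‖T‖ ^ 2)⁻¹ (1 - r⁻¹) * c ≤ ‖⟪y, f⟫_𝕜‖ ^ 2 := by
  let W : Submodule 𝕜 K := V ⊔ (𝕜 ∙ f) ⊔ (𝕜 ∙ T.adjoint (T f))
  have hspec : ∀ g ∈ Wᗮ, g ∈ Vᗮ ∧ ⟪f, g⟫_𝕜 = 0 ∧ ⟪T f, T g⟫_𝕜 = 0 := fun g hg =>
    ⟨Submodule.orthogonal_le (le_sup_left.trans le_sup_left) hg,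
      hg f (Submodule.mem_sup_left (Submodule.mem_sup_right (Submodule.mem_span_singleton_self f))),
      by
        rw [← ContinuousLinearMap.adjoint_inner_left]
        exact hg _ (Submodule.mem_sup_right (Submodule.mem_span_singleton_self _))⟩
  rcases le_or_gt c (‖T f‖ ^ 2) with hcd | hcd
  · obtain ⟨g, hgW, hg1, hTg⟩ := hzero W inferInstance
    obtain ⟨hgV, hfg, hTfg⟩ := hspec g hgW
    have hd : 0 < ‖T f‖ ^ 2 := hc0.trans_le hcd
    obtain ⟨y, hyV, hy1, hTy, hyf⟩ := exists_unit_interpolating T Vᗮ hfV hgV hf1 hg1 hfg hTfg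
      (div_nonneg hc0.le hd.le) ((div_le_one hd).2 hcd)
    refine ⟨y, hyV, hy1, ?_, ?_⟩
    · rw [hTy, hTg, div_mul_cancel₀ _ hd.ne']
      simp
    · have hTf : ‖T f‖ ≤ ‖T‖ := by simpa [hf1] using T.le_opNorm f
      rw [hyf, div_eq_inv_mul]
      gcongr
      exact (min_le_left _ _).trans (by gcongr)
  · obtain ⟨g, hgW, hg1, hTg⟩ := hlarge W inferInstance
    obtain ⟨hgV, hfg, hTfg⟩ := hspec g hgW
    have hd : 0 ≤ ‖T f‖ ^ 2 := by positivity
    set d := ‖T f‖ ^ 2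
    set q := ‖T g‖ ^ 2
    have hqd : 0 < q - d := by linarith
    obtain ⟨y, hyV, hy1, hTy, hyf⟩ := exists_unit_interpolating T Vᗮ hfV hgV hf1 hg1 hfg hTfg
      (s := (q - c) / (q - d)) (div_nonneg (by linarith) hqd.le)
      ((div_le_one hqd).2 (by linarith))
    refine ⟨y, hyV, hy1, ?_, ?_⟩
    · rw [hTy]
      field_simp
      ring
    · have hr0 : 0 < 1 - r⁻¹ := by
        have := inv_lt_one_of_one_lt₀ hr
        linarith
      rw [hyf]
      calc min (‖T‖ ^ 2)⁻¹ (1 - r⁻¹) * c ≤ (1 - r⁻¹) * 1 := by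
            gcongr
            exact min_le_right _ _
        _ ≤ (q - c) / (q - d) := by
            rw [mul_one, le_div_iff₀ hqd]
            have hqr : 1 ≤ r⁻¹ * q := by
              rw [inv_mul_eq_div, one_le_div (by linarith)]
              exact hTg.le
            nlinarith

/-- Version of `exists_unit_norm_sq_eq_of_unit` for an arbitrary target vector `w`, whose distance
to `V` is controlled. -/
lemma exists_unit_norm_sq_eq (hr : 1 < r)
    (hlarge : ∀ V : Submodule 𝕜 K, FiniteDimensional 𝕜 V → ∃ g ∈ Vᗮ, ‖g‖ = 1 ∧ r < ‖T g‖ ^ 2)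
    (hzero : ∀ V : Submodule 𝕜 K, FiniteDimensional 𝕜 V → ∃ g ∈ Vᗮ, ‖g‖ = 1 ∧ T g = 0)
    (V : Submodule 𝕜 K) [FiniteDimensional 𝕜 V] (w : K) {c : ℝ} (hc0 : 0 < c) (hc1 : c ≤ 1) :
    ∃ y ∈ Vᗮ, ‖y‖ = 1 ∧ ‖T y‖ ^ 2 = c ∧ ∃ v ∈ V,
      min (‖T‖ ^ 2)⁻¹ (1 - r⁻¹) * c * ‖w - v‖ ^ 2 ≤ ‖⟪y, w⟫_𝕜‖ ^ 2 := by
  set v := V.starProjection w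
  have hvV : v ∈ V := V.starProjection_apply_mem w
  have hwv : w - v ∈ Vᗮ := V.sub_starProjection_mem_orthogonal w
  rcases eq_or_ne (w - v) 0 with h0 | h0
  · obtain ⟨g, hgV, hg1, -⟩ := hzero V inferInstance
    obtain ⟨y, hyV, hy1, hTy, -⟩ :=
      exists_unit_norm_sq_eq_of_unit hr hlarge hzero V hgV hg1 hc0 hc1
    exact ⟨y, hyV, hy1, hTy, v, hvV, by rw [h0]; simp⟩
  · obtain ⟨y, hyV, hy1, hTy, hyf⟩ := exists_unit_norm_sq_eq_of_unit hr hlarge hzero V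
      (Vᗮ.smul_mem ((‖w - v‖⁻¹ : ℝ) : 𝕜) hwv)
      (by rw [norm_smul, RCLike.norm_ofReal, abs_inv, abs_norm,
        inv_mul_cancel₀ (norm_ne_zero_iff.2 h0)]) hc0 hc1
    refine ⟨y, hyV, hy1, hTy, v, hvV, ?_⟩
    have hyw : ⟪y, w⟫_𝕜 = ⟪y, w - v⟫_𝕜 := by
      rw [inner_sub_right, Submodule.inner_left_of_mem_orthogonal hvV hyV, sub_zero]
    have hpos : 0 < ‖w - v‖ ^ 2 := by positivity
    rw [inner_smul_right, norm_mul, RCLike.norm_ofReal, abs_inv, abs_norm, mul_pow, inv_pow,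
      ← div_eq_inv_mul, le_div_iff₀ hpos] at hyf
    rwa [hyw]

/-- A Hilbert basis on which the quadratic form `‖T y‖ ^ 2` takes prescribed values. -/
theorem exists_hilbertBasis_norm_sq_eq [TopologicalSpace.SeparableSpace K] (hr : 1 < r)
    (hlarge : ∀ V : Submodule 𝕜 K, FiniteDimensional 𝕜 V → ∃ g ∈ Vᗮ, ‖g‖ = 1 ∧ r < ‖T g‖ ^ 2)
    (hzero : ∀ V : Submodule 𝕜 K, FiniteDimensional 𝕜 V → ∃ g ∈ Vᗮ, ‖g‖ = 1 ∧ T g = 0)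
    {c : ℕ → ℝ} (hcpos : ∀ i, 0 < c i) (hcle : ∀ i, c i ≤ 1)
    (hdiv : Filter.Tendsto (fun N => ∑ i ∈ Finset.range N, c i) Filter.atTop Filter.atTop) :
    ∃ b : HilbertBasis ℕ 𝕜 K, ∀ n, ‖T (b n)‖ ^ 2 = c n := by
  obtain ⟨τ, hτ⟩ := exists_partition_not_summable hcpos hcle hdiv
  set η := min (‖T‖ ^ 2)⁻¹ (1 - r⁻¹)
  have hη0 : 0 < η := by
    have hT : 0 < ‖T‖ := by
      obtain ⟨g, -, hg1, hTg⟩ := hlarge ⊥ inferInstance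
      refine norm_pos_iff.2 fun h => ?_
      rw [h] at hTg
      norm_num at hTg
      linarith
    have := inv_lt_one_of_one_lt₀ hr
    exact lt_min (by positivity) (by linarith)
  let w : ℕ → K := TopologicalSpace.denseSeq K
  choose! next hnext_orth hnext_norm hnext_T hnext_dist using
    fun (n : ℕ) (V : Submodule 𝕜 K) (_ : FiniteDimensional 𝕜 V) =>
      exists_unit_norm_sq_eq hr hlarge hzero V (w (τ n)) (hcpos n) (hcle n)
  obtain ⟨V, hVzero, hVsucc⟩ : ∃ V : ℕ → Submodule 𝕜 K, V 0 = ⊥ ∧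
      ∀ n, V (n + 1) = V n ⊔ (𝕜 ∙ next n (V n)) :=
    ⟨fun n => n.rec ⊥ fun n V => V ⊔ (𝕜 ∙ next n V), rfl, fun _ => rfl⟩
  have hVfin : ∀ n : ℕ, FiniteDimensional 𝕜 ↥(V n) := by
    intro n
    induction n with
    | zero => rw [hVzero]; infer_instance
    | succ n ih => rw [hVsucc]; infer_instance
  have hVmono : Monotone V := monotone_nat_of_le_succ fun n => by rw [hVsucc]; exact le_sup_left
  let y : ℕ → K := fun n => next n (V n)
  have hyV : ∀ n, y n ∈ V (n + 1) := fun n => by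
    rw [hVsucc]
    exact Submodule.mem_sup_right (Submodule.mem_span_singleton_self _)
  have hlt : ∀ m n, m < n → ⟪y m, y n⟫_𝕜 = 0 := fun m n hmn =>
    hnext_orth n (V n) (hVfin n) _ (hVmono hmn (hyV m))
  have hy : Orthonormal 𝕜 y := ⟨fun n => hnext_norm n (V n) (hVfin n), fun m n hmn => by
    rcases hmn.lt_or_gt with h | h
    · exact hlt m n h
    · exact inner_eq_zero_symm.1 (hlt n m h)⟩
  have hVle : ∀ n, V n ≤ Submodule.span 𝕜 (Set.range y) := fun n => by
    induction n with
    | zero => rw [hVzero]; exact bot_le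
    | succ n ih =>
      rw [hVsucc, sup_le_iff, Submodule.span_singleton_le_iff_mem]
      exact ⟨ih, Submodule.subset_span ⟨n, rfl⟩⟩
  let S : Set K := (Submodule.span 𝕜 (Set.range y) : Submodule 𝕜 K)
  have hSne : S.Nonempty := ⟨0, Submodule.zero_mem _⟩
  have hwS : ∀ j, w j ∈ closure S := fun j => by
    rw [Metric.mem_closure_iff_infDist_zero hSne]
    by_contra hne
    have hδ : 0 < Metric.infDist (w j) S := Metric.infDist_nonneg.lt_of_ne' hne
    refine hτ j ?_
    have hsum := (hy.inner_products_summable (w j)).mul_left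
      (η * Metric.infDist (w j) S ^ 2)⁻¹
    refine hsum.of_nonneg_of_le (fun n => ?_) fun n => ?_
    · split_ifs
      exacts [(hcpos n).le, le_rfl]
    · split_ifs with hn
      · obtain ⟨v, hv, hdist⟩ := hnext_dist n (V n) (hVfin n)
        rw [hn] at hdist
        have hle : Metric.infDist (w j) S ≤ ‖w j - v‖ := by
          rw [← dist_eq_norm]
          exact Metric.infDist_le_dist_of_mem (hVle n hv)
        rw [inv_mul_eq_div, le_div_iff₀ (by positivity)]
        have := (hcpos n).le
        calc c n * (η * Metric.infDist (w j) S ^ 2) = η * c n * Metric.infDist (w j) S ^ 2 := by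
              ring
          _ ≤ η * c n * ‖w j - v‖ ^ 2 := by gcongr
          _ ≤ _ := hdist
      · positivity
  have hdense : ⊤ ≤ (Submodule.span 𝕜 (Set.range y)).topologicalClosure := fun x _ => by
    have hsub : closure (Set.range w) ⊆ closure S :=
      closure_minimal (Set.range_subset_iff.2 hwS) isClosed_closure
    exact hsub (TopologicalSpace.denseRange_denseSeq K x)
  refine ⟨HilbertBasis.mk hy hdense, fun n => ?_⟩
  rw [HilbertBasis.coe_mk]
  exact hnext_T n (V n) (hVfin n)

end DiagonalBasis

lemma exists_unit_mem_orthogonal {𝕜 H : Type*} [RCLike 𝕜] [NormedAddCommGroup H]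
    [InnerProductSpace 𝕜 H] (hinf : ¬ FiniteDimensional 𝕜 H) (V : Submodule 𝕜 H)
    [FiniteDimensional 𝕜 V] : ∃ g ∈ Vᗮ, ‖g‖ = 1 := by
  have hV : Vᗮ ≠ ⊥ := fun h => hinf <| by
    rw [Submodule.orthogonal_eq_bot_iff] at h
    subst h
    exact Module.Finite.equiv (Submodule.topEquiv (R := 𝕜) (M := H))
  obtain ⟨h, hhV, hh0⟩ := Submodule.exists_mem_ne_zero_of_ne_bot hV
  refine ⟨((‖h‖⁻¹ : ℝ) : 𝕜) • h, Vᗮ.smul_mem _ hhV, ?_⟩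
  rw [norm_smul, RCLike.norm_ofReal, abs_inv, abs_norm, inv_mul_cancel₀ (norm_ne_zero_iff.2 hh0)]

/-- A positive operator `B` on an infinite-dimensional separable Hilbert space factors as `T T†`
through a separable Hilbert space on which `T` has infinite-dimensional kernel. -/
lemma ContinuousLinearMap.IsPositive.exists_comp_adjoint_eq.{u, v} {𝕜 : Type u} {H : Type v}
    [RCLike 𝕜] [NormedAddCommGroup H] [InnerProductSpace 𝕜 H] [CompleteSpace H]
    [TopologicalSpace.SeparableSpace H] (hinf : ¬ FiniteDimensional 𝕜 H)
    {B : H →L[𝕜] H} (hB : B.IsPositive) :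
    ∃ (K : Type v) (_ : NormedAddCommGroup K) (_ : InnerProductSpace 𝕜 K) (_ : CompleteSpace K)
      (_ : TopologicalSpace.SeparableSpace K) (T : K →L[𝕜] H), T ∘L T.adjoint = B ∧
      ∀ V : Submodule 𝕜 K, FiniteDimensional 𝕜 V → ∃ g ∈ Vᗮ, ‖g‖ = 1 ∧ T g = 0 := by
  obtain ⟨L, _, _, _, J, hJ, hin⟩ := hB.exists_factorization
  have : TopologicalSpace.SeparableSpace L := hJ.separableSpace J.continuous
  let e : WithLp 2 (L × H) ≃L[𝕜] L × H := WithLp.prodContinuousLinearEquiv 2 𝕜 L H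
  have : TopologicalSpace.SeparableSpace (WithLp 2 (L × H)) :=
    e.symm.surjective.denseRange.separableSpace e.symm.continuous
  let p : WithLp 2 (L × H) →L[𝕜] L := WithLp.fstL 2 𝕜 L H
  have hp : p ∘L p.adjoint = ContinuousLinearMap.id 𝕜 L := by
    have hadj : ∀ x, p.adjoint x = WithLp.toLp 2 (x, 0) := fun x => ext_inner_right 𝕜 fun z => by
      rw [ContinuousLinearMap.adjoint_inner_left, WithLp.prod_inner_apply]
      simp [p]
    ext x
    rw [ContinuousLinearMap.comp_apply, hadj]
    rfl
  refine ⟨WithLp 2 (L × H), inferInstance, inferInstance, inferInstance, inferInstance,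
    J.adjoint ∘L p, ?_, fun V _ => ?_⟩
  · ext x
    refine ext_inner_right 𝕜 fun z => ?_
    have hpx : ∀ x, p (p.adjoint x) = x := fun x => DFunLike.congr_fun hp x
    rw [ContinuousLinearMap.adjoint_comp, ContinuousLinearMap.adjoint_adjoint]
    simp only [ContinuousLinearMap.comp_apply, hpx]
    rw [ContinuousLinearMap.adjoint_inner_left, hin]
  · let q : WithLp 2 (L × H) →L[𝕜] H := WithLp.sndL 2 𝕜 L H
    obtain ⟨h, hhV, hh1⟩ := exists_unit_mem_orthogonal hinf (V.map q.toLinearMap)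
    refine ⟨WithLp.toLp 2 (0, h), fun v hv => ?_, ?_, ?_⟩
    · rw [WithLp.prod_inner_apply]
      simpa [q] using hhV (q v) (Submodule.mem_map_of_mem hv)
    · simpa using hh1
    · simp [p]

/-- Let `B` be a positive bounded operator with `‖B‖_ess > 1` on an infinite-dimensional
separable real or complex Hilbert space, and let `{c i}` satisfy `0 < c i ≤ 1` and
`∑ c i = ∞`. Then there is a sequence of rank-one projections `P i = x i ⊗ x i` (with
`‖x i‖ = 1`) such that `B = ∑ i, c i • P i` in the strong operator topology. -/
theorem rank_one_decomposition_of_essNorm_gt_one {𝕜 H : Type*} [RCLike 𝕜]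
    [NormedAddCommGroup H] [InnerProductSpace 𝕜 H] [CompleteSpace H]
    [TopologicalSpace.SeparableSpace H]
    (hinf : ¬ FiniteDimensional 𝕜 H)
    (B : H →L[𝕜] H) (hB : B.IsPositive) (hBess : 1 < essNorm B)
    (c : ℕ → ℝ) (hcpos : ∀ i, 0 < c i) (hcle : ∀ i, c i ≤ 1)
    (hdiv : Filter.Tendsto (fun N => ∑ i ∈ Finset.range N, c i) Filter.atTop Filter.atTop) :
    ∃ x : ℕ → H, (∀ i, ‖x i‖ = 1) ∧
      ∀ v : H, Filter.Tendsto
        (fun N => ∑ i ∈ Finset.range N, (c i : 𝕜) • (rankOne 𝕜 (x i) (x i) v))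
        Filter.atTop (nhds (B v)) := by
  obtain ⟨r, hr, hrB⟩ := exists_between hBess
  obtain ⟨K, _, _, _, _, T, hT, hzero⟩ := hB.exists_comp_adjoint_eq hinf
  obtain ⟨b, hb⟩ := exists_hilbertBasis_norm_sq_eq hr
    (fun V _ => exists_unit_mem_orthogonal_lt_norm_sq hT (by linarith) hrB V) hzero hcpos hcle hdiv
  have hTb : ∀ i, 0 < ‖T (b i)‖ := fun i =>
    (norm_nonneg _).lt_of_ne' fun h => (hcpos i).ne' (by rw [← hb, h]; simp)
  refine ⟨fun i => ((‖T (b i)‖⁻¹ : ℝ) : 𝕜) • T (b i), fun i => ?_, fun v => ?_⟩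
  · rw [norm_smul, RCLike.norm_ofReal, abs_inv, abs_norm, inv_mul_cancel₀ (hTb i).ne']
  · have hsum := ((b.hasSum_repr (T.adjoint v)).mapL T).tendsto_sum_nat
    have hTv : T (T.adjoint v) = B v := DFunLike.congr_fun hT v
    rw [hTv] at hsum
    refine hsum.congr fun N => Finset.sum_congr rfl fun i _ => ?_
    have hne : ((‖T (b i)‖ : ℝ) : 𝕜) ≠ 0 := RCLike.ofReal_ne_zero.2 (hTb i).ne'
    rw [b.repr_apply_apply, ContinuousLinearMap.adjoint_inner_right, map_smul, rankOne,
      ContinuousLinearMap.smulRight_apply, innerSL_apply_apply, inner_smul_left, smul_smul,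
      smul_smul, ← hb i, RCLike.conj_ofReal]
    congr 1
    push_cast
    field_simp
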